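/- arXiv:1706.07731 — 2 statements merged into one kernel-verified Lean document; each statement's English description precedes it below -/
import Mathlib

section
/- Under the standing assumptions, for every input distribution P on 𝒳, η·I₁(P) + (1−η)·I₂(P) ≤ C. -/
open Finset

noncomputable section

variable {𝒳 𝒴 : Type*} [Fintype 𝒳] [Fintype 𝒴]

/-- `P` is a probability distribution on the finite alphabet `𝒳`. -/
def IsDist (P : 𝒳 → ℝ) : Prop := (∀ x, 0 ≤ P x) ∧ ∑ x, P x = 1

/-- The output distribution `PW` induced by input distribution `P` and channel `W`. -/
def outDist (P : 𝒳 → ℝ) (W : 𝒳 → 𝒴 → ℝ) (y : 𝒴) : ℝ := ∑ x, P x * W x y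

/-- The mutual information `I(P, W)` (natural logarithm). -/
def mutInfo (P : 𝒳 → ℝ) (W : 𝒳 → 𝒴 → ℝ) : ℝ :=
  ∑ x, ∑ y, P x * W x y * Real.log (W x y / outDist P W y)

/-- Relative entropy (KL divergence) between two pmfs on a finite alphabet. -/
def relEnt (p q : 𝒴 → ℝ) : ℝ := ∑ y, p y * Real.log (p y / q y)

/-- Directional derivative `∇I_k(v)` of the mutual information at `P*` along `v`. -/
def gradI (Pstar : 𝒳 → ℝ) (W : 𝒳 → 𝒴 → ℝ) (v : 𝒳 → ℝ) : ℝ :=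
  ∑ x, v x * relEnt (W x) (outDist Pstar W)


/-- Bounding the mutual information by the average divergence to the output distribution of a
positive input vector with the same total mass. -/
theorem mutInfo_le_sum_mul_relEnt {W : 𝒳 → 𝒴 → ℝ} (hW : ∀ x y, 0 ≤ W x y)
    (hWsum : ∀ x, ∑ y, W x y = 1) {P R : 𝒳 → ℝ} (hP : IsDist P) (hR : IsDist R)
    (hRpos : ∀ x, 0 < R x) :
    mutInfo P W ≤ ∑ x, P x * relEnt (W x) (outDist R W) := by
  have sum_outDist : ∀ {Q : 𝒳 → ℝ}, IsDist Q → ∑ y, outDist Q W y = 1 := by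
    intro Q hQ
    simp only [outDist]
    rw [sum_comm]
    simp only [← mul_sum, hWsum, mul_one]
    exact hQ.2
  have hterm : ∀ x y, P x * W x y * Real.log (W x y / outDist P W y) ≤
      P x * W x y * Real.log (W x y / outDist R W y) +
        P x * W x y * (outDist R W y / outDist P W y - 1) := by
    intro x y
    rcases (mul_nonneg (hP.1 x) (hW x y)).eq_or_lt with h0 | hpos
    · simp [← h0]
    have hw : 0 < W x y := pos_of_mul_pos_right hpos (hP.1 x)
    have hp : 0 < outDist P W y :=
      hpos.trans_le (single_le_sum (f := fun x => P x * W x y)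
        (fun i _ => mul_nonneg (hP.1 i) (hW i y)) (mem_univ x))
    have hq : 0 < outDist R W y :=
      (mul_pos (hRpos x) hw).trans_le (single_le_sum (f := fun x => R x * W x y)
        (fun i _ => mul_nonneg (hR.1 i) (hW i y)) (mem_univ x))
    rw [← mul_add]
    refine mul_le_mul_of_nonneg_left ?_ hpos.le
    have := Real.log_le_sub_one_of_pos (div_pos hq hp)
    rw [Real.log_div hq.ne' hp.ne'] at this
    rw [Real.log_div hw.ne' hp.ne', Real.log_div hw.ne' hq.ne']
    linarith
  have hexcess : ∑ x, ∑ y, P x * W x y * (outDist R W y / outDist P W y - 1) ≤ 0 := by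
    rw [sum_comm]
    calc ∑ y, ∑ x, P x * W x y * (outDist R W y / outDist P W y - 1)
        = ∑ y, outDist P W y * (outDist R W y / outDist P W y - 1) := by
          simp only [← sum_mul, outDist]
      _ ≤ ∑ y, (outDist R W y - outDist P W y) := by
          refine sum_le_sum fun y _ => ?_
          by_cases h : outDist P W y = 0
          · rw [h, zero_mul, sub_zero]
            exact sum_nonneg fun i _ => mul_nonneg (hR.1 i) (hW i y)
          · rw [mul_sub, mul_div_cancel₀ _ h, mul_one]
      _ = 0 := by rw [sum_sub_distrib, sum_outDist hR, sum_outDist hP, sub_self]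
  calc mutInfo P W
      ≤ ∑ x, ∑ y, (P x * W x y * Real.log (W x y / outDist R W y) +
        P x * W x y * (outDist R W y / outDist P W y - 1)) :=
        sum_le_sum fun x _ => sum_le_sum fun y _ => hterm x y
    _ ≤ ∑ x, ∑ y, P x * W x y * Real.log (W x y / outDist R W y) := by
        simp only [sum_add_distrib]
        linarith
    _ = ∑ x, P x * relEnt (W x) (outDist R W) := by
        simp only [relEnt, mul_sum, mul_assoc]

theorem mutInfo_eq_sum_mul_relEnt (P : 𝒳 → ℝ) (W : 𝒳 → 𝒴 → ℝ) :
    mutInfo P W = ∑ x, P x * relEnt (W x) (outDist P W) := by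
  simp only [mutInfo, relEnt, mul_sum, mul_assoc]

theorem IsDist.segment {P Q : 𝒳 → ℝ} (hP : IsDist P) (hQ : IsDist Q) {t : ℝ} (ht0 : 0 ≤ t)
    (ht1 : t ≤ 1) : IsDist fun x => (1 - t) * P x + t * Q x := by
  refine ⟨fun x => add_nonneg (mul_nonneg (sub_nonneg.2 ht1) (hP.1 x))
    (mul_nonneg ht0 (hQ.1 x)), ?_⟩
  rw [sum_add_distrib, ← mul_sum, ← mul_sum, hP.2, hQ.2]
  ring

/-- Concavity of the mutual information along segments issuing from a positive distribution. -/
theorem mutInfo_segment_ge {W : 𝒳 → 𝒴 → ℝ} (hW : ∀ x y, 0 ≤ W x y)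
    (hWsum : ∀ x, ∑ y, W x y = 1) {P Q : 𝒳 → ℝ} (hP : IsDist P) (hPpos : ∀ x, 0 < P x)
    (hQ : IsDist Q) {t : ℝ} (ht0 : 0 ≤ t) (ht1 : t < 1) :
    (1 - t) * mutInfo P W + t * mutInfo Q W ≤
      mutInfo (fun x => (1 - t) * P x + t * Q x) W := by
  have hR := hP.segment hQ ht0 ht1.le
  have hRpos : ∀ x, 0 < (1 - t) * P x + t * Q x := fun x =>
    add_pos_of_pos_of_nonneg (mul_pos (sub_pos.2 ht1) (hPpos x)) (mul_nonneg ht0 (hQ.1 x))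
  rw [mutInfo_eq_sum_mul_relEnt (fun x => (1 - t) * P x + t * Q x)]
  simp only [add_mul, sum_add_distrib, mul_assoc, ← mul_sum]
  exact add_le_add
    (mul_le_mul_of_nonneg_left (mutInfo_le_sum_mul_relEnt hW hWsum hP hR hRpos)
      (sub_nonneg.2 ht1.le))
    (mul_le_mul_of_nonneg_left (mutInfo_le_sum_mul_relEnt hW hWsum hQ hR hRpos) ht0)

/-- At a positive maximizer of the minimum of two mutual informations, a channel whose own
capacity exceeds the maximum cannot be the strictly worse one. -/
theorem mutInfo_le_of_max_min {U V : 𝒳 → 𝒴 → ℝ}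
    (hU : ∀ x y, 0 ≤ U x y) (hUsum : ∀ x, ∑ y, U x y = 1)
    (hV : ∀ x y, 0 ≤ V x y) (hVsum : ∀ x, ∑ y, V x y = 1)
    {P Q : 𝒳 → ℝ} (hP : IsDist P) (hPpos : ∀ x, 0 < P x)
    (hmax : ∀ R, IsDist R →
      min (mutInfo R U) (mutInfo R V) ≤ min (mutInfo P U) (mutInfo P V))
    (hQ : IsDist Q) (hlt : min (mutInfo P U) (mutInfo P V) < mutInfo Q V) :
    mutInfo P U ≤ mutInfo P V := by
  by_contra! h
  rw [min_eq_right h.le] at hmax hlt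
  set δ := mutInfo P U - mutInfo P V with hδ
  set M := |mutInfo P U - mutInfo Q U| with hM
  have hδ0 : 0 < δ := sub_pos.2 h
  have hM0 : 0 ≤ M := abs_nonneg _
  obtain ⟨t, ht⟩ : ∃ t, t = δ / (2 * (M + δ)) := ⟨_, rfl⟩
  have ht0 : 0 < t := by rw [ht]; positivity
  have ht1 : t < 1 := by rw [ht, div_lt_one (by positivity)]; linarith
  have htM : t * M < δ := by
    rw [ht, div_mul_eq_mul_div, div_lt_iff₀ (by positivity)]
    nlinarith [mul_nonneg hδ0.le hM0, mul_pos hδ0 hδ0]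
  have hbound : t * (mutInfo P U - mutInfo Q U) ≤ t * M :=
    mul_le_mul_of_nonneg_left (le_abs_self _) ht0.le
  have hUseg := mutInfo_segment_ge hU hUsum hP hPpos hQ ht0.le ht1
  have hVseg := mutInfo_segment_ge hV hVsum hP hPpos hQ ht0.le ht1
  refine (hmax _ (hP.segment hQ ht0.le ht1.le)).not_gt (lt_min ?_ ?_)
  · linarith
  · linarith [mul_pos ht0 (sub_pos.2 hlt)]

/-- First-order upper bound for the mutual information at a positive distribution. -/
theorem mutInfo_le_add_gradI {W : 𝒳 → 𝒴 → ℝ} (hW : ∀ x y, 0 ≤ W x y)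
    (hWsum : ∀ x, ∑ y, W x y = 1) {P R : 𝒳 → ℝ} (hP : IsDist P) (hR : IsDist R)
    (hRpos : ∀ x, 0 < R x) :
    mutInfo P W ≤ mutInfo R W + gradI R W fun x => P x - R x := by
  have h := mutInfo_le_sum_mul_relEnt hW hWsum hP hR hRpos
  rw [mutInfo_eq_sum_mul_relEnt R W]
  simp only [gradI, sub_mul, sum_sub_distrib]
  linarith

/-- For every input distribution `P`, `η·I₁(P) + (1-η)·I₂(P) ≤ C`. -/
theorem eta_weighted_mutInfo_le_capacity
    (W1 W2 : 𝒳 → 𝒴 → ℝ)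
    (hW1 : ∀ x y, 0 ≤ W1 x y) (hW1sum : ∀ x, ∑ y, W1 x y = 1)
    (hW2 : ∀ x y, 0 ≤ W2 x y) (hW2sum : ∀ x, ∑ y, W2 x y = 1)
    (Pstar : 𝒳 → ℝ) (C C1 C2 : ℝ)
    (hPstar : IsDist Pstar) (hPpos : ∀ x, 0 < Pstar x)
    (hCach : min (mutInfo Pstar W1) (mutInfo Pstar W2) = C)
    (hCmax : ∀ P, IsDist P → min (mutInfo P W1) (mutInfo P W2) ≤ C)
    (hUniq : ∀ P, IsDist P → min (mutInfo P W1) (mutInfo P W2) = C → P = Pstar)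
    (hC1 : IsLUB {r | ∃ P, IsDist P ∧ r = mutInfo P W1} C1)
    (hC2 : IsLUB {r | ∃ P, IsDist P ∧ r = mutInfo P W2} C2)
    (hC1gt : C < C1) (hC2gt : C < C2)
    (η : ℝ) (hη : η ∈ Set.Ioo (0 : ℝ) 1)
    (hηeq : ∀ v : 𝒳 → ℝ, ∑ x, v x = 0 →
      η * gradI Pstar W1 v + (1 - η) * gradI Pstar W2 v = 0)
    :
    ∀ P : 𝒳 → ℝ, IsDist P → η * mutInfo P W1 + (1 - η) * mutInfo P W2 ≤ C := by
  intro P hP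
  have hmax : ∀ R, IsDist R → min (mutInfo R W1) (mutInfo R W2) ≤
      min (mutInfo Pstar W1) (mutInfo Pstar W2) := fun R hR => hCach ▸ hCmax R hR
  obtain ⟨_, ⟨Q1, hQ1, rfl⟩, hlt1, -⟩ := hC1.exists_between hC1gt
  obtain ⟨_, ⟨Q2, hQ2, rfl⟩, hlt2, -⟩ := hC2.exists_between hC2gt
  have h12 : mutInfo Pstar W1 ≤ mutInfo Pstar W2 :=
    mutInfo_le_of_max_min hW1 hW1sum hW2 hW2sum hPstar hPpos hmax hQ2 (hCach ▸ hlt2)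
  have h21 : mutInfo Pstar W2 ≤ mutInfo Pstar W1 :=
    mutInfo_le_of_max_min hW2 hW2sum hW1 hW1sum hPstar hPpos
      (by simpa only [min_comm] using hmax) hQ1 (by rw [min_comm, hCach]; exact hlt1)
  have hI1 : mutInfo Pstar W1 = C := by rw [← hCach, min_eq_left h12]
  have hI2 : mutInfo Pstar W2 = C := by rw [← hCach, min_eq_right h21]
  have hgrad := hηeq (fun x => P x - Pstar x) (by rw [sum_sub_distrib, hP.2, hPstar.2, sub_self])
  have hb1 := mul_le_mul_of_nonneg_left
    (mutInfo_le_add_gradI hW1 hW1sum hP hPstar hPpos) hη.1.le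
  have hb2 := mul_le_mul_of_nonneg_left
    (mutInfo_le_add_gradI hW2 hW2sum hP hPstar hPpos) (sub_nonneg.2 hη.2.le)
  rw [hI1] at hb1
  rw [hI2] at hb2
  linarith
end
end

section
/- (Nonasymptotic converse for fixed-length feedback codes.) Every (n, M, ε)-FLF code for the CM-DMBC satisfies, for every λ > 0: ε ≥ (1/2)·ℙ[ Σ_{k∈{1,2}} η_k · Σ_{i=1}^n i_{P*,W_k}( f_i(J, Y₁^{i−1}, Y₂^{i−1}) ; Y_{k,i} ) ≤ log M − λ ] − e^{−λ}, where ℙ is the joint law of (J, Y₁ⁿ, Y₂ⁿ) induced by the code. -/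
open Finset

noncomputable section

variable {𝒳 𝒴 : Type*} [Fintype 𝒳] [Fintype 𝒴]

/-- Per-symbol information density `i_{P,W}(x;y)`. -/
def infoDens (P : 𝒳 → ℝ) (W : 𝒳 → 𝒴 → ℝ) (x : 𝒳) (y : 𝒴) : ℝ :=
  Real.log (W x y / outDist P W y)

/-- Causality of a feedback encoder: the input at time `i` depends on the message and
on the channel outputs at times `< i` only. -/
def Causal (n M : ℕ) (f : Fin M → (Fin n → 𝒴) → (Fin n → 𝒴) → Fin n → 𝒳) : Prop :=
  ∀ (j : Fin M) (y1 y1' y2 y2' : Fin n → 𝒴) (i : Fin n),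
    (∀ t, t < i → y1 t = y1' t) → (∀ t, t < i → y2 t = y2' t) →
      f j y1 y2 i = f j y1' y2' i

/-- The joint law `ℙ(j, y₁ⁿ, y₂ⁿ)` induced by an FLF code:
`(1/M) ∏ᵢ W₁(y₁ᵢ | fᵢ(j, y₁^{i-1}, y₂^{i-1})) W₂(y₂ᵢ | fᵢ(j, y₁^{i-1}, y₂^{i-1}))`. -/
def codeLaw (W1 W2 : 𝒳 → 𝒴 → ℝ) (n M : ℕ)
    (f : Fin M → (Fin n → 𝒴) → (Fin n → 𝒴) → Fin n → 𝒳)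
    (j : Fin M) (y1 y2 : Fin n → 𝒴) : ℝ :=
  (1 / M) * ∏ i, (W1 (f j y1 y2 i) (y1 i) * W2 (f j y1 y2 i) (y2 i))

/-- Error probability `ℙ[g(Y₁ⁿ) ≠ J]` at decoder 1. -/
def errProb1 (W1 W2 : 𝒳 → 𝒴 → ℝ) (n M : ℕ)
    (f : Fin M → (Fin n → 𝒴) → (Fin n → 𝒴) → Fin n → 𝒳)
    (g : (Fin n → 𝒴) → Fin M) : ℝ :=
  ∑ j, ∑ y1 : Fin n → 𝒴, ∑ y2 : Fin n → 𝒴,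
    if g y1 = j then 0 else codeLaw W1 W2 n M f j y1 y2

/-- Error probability `ℙ[g(Y₂ⁿ) ≠ J]` at decoder 2. -/
def errProb2 (W1 W2 : 𝒳 → 𝒴 → ℝ) (n M : ℕ)
    (f : Fin M → (Fin n → 𝒴) → (Fin n → 𝒴) → Fin n → 𝒳)
    (g : (Fin n → 𝒴) → Fin M) : ℝ :=
  ∑ j, ∑ y1 : Fin n → 𝒴, ∑ y2 : Fin n → 𝒴,
    if g y2 = j then 0 else codeLaw W1 W2 n M f j y1 y2

omit [Fintype 𝒳] in
/-- Summing a product channel law over all output sequences gives one, when each input depends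
on the strictly earlier outputs only. -/
theorem sum_prod_causal [Nonempty 𝒴] (W : 𝒳 → 𝒴 → ℝ) (hW : ∀ x, ∑ y, W x y = 1) (n : ℕ)
    (h : (Fin n → 𝒴) → Fin n → 𝒳)
    (hh : ∀ (y y' : Fin n → 𝒴) (i : Fin n), (∀ t, t < i → y t = y' t) → h y i = h y' i) :
    ∑ y, ∏ i, W (h y i) (y i) = 1 := by
  induction n with
  | zero => simp
  | succ n ih =>
    obtain ⟨d⟩ := ‹Nonempty 𝒴›
    rw [← (Fin.consEquiv fun _ : Fin (n + 1) => 𝒴).sum_comp, Fintype.sum_prod_type,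
      ← hW (h (fun _ => d) 0)]
    refine Finset.sum_congr rfl fun y₀ _ => ?_
    have h₀ (y : Fin n → 𝒴) :
        h (Fin.cons y₀ y : Fin (n + 1) → 𝒴) 0 = h (fun _ => d) 0 :=
      hh _ _ _ fun t ht => absurd ht (Fin.not_lt_zero t)
    change ∑ y : Fin n → 𝒴, ∏ i, W (h (Fin.cons y₀ y : Fin (n + 1) → 𝒴) i)
      ((Fin.cons y₀ y : Fin (n + 1) → 𝒴) i) = _
    simp only [Fin.prod_univ_succ, Fin.cons_zero, Fin.cons_succ, h₀]
    rw [← Finset.mul_sum,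
      ih (fun y i => h (Fin.cons y₀ y : Fin (n + 1) → 𝒴) i.succ) fun y y' i hy => ?_, mul_one]
    refine hh _ _ _ fun t ht => ?_
    cases t using Fin.cases with
    | zero => simp
    | succ t => simpa using hy t (Fin.succ_lt_succ_iff.mp ht)

omit [Fintype 𝒴] in
theorem outDist_nonneg {P : 𝒳 → ℝ} {W : 𝒳 → 𝒴 → ℝ} (hP : ∀ x, 0 ≤ P x)
    (hW : ∀ x y, 0 ≤ W x y) (y : 𝒴) : 0 ≤ outDist P W y :=
  Finset.sum_nonneg fun x _ => mul_nonneg (hP x) (hW x y)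

omit [Fintype 𝒴] in
theorem outDist_pos {P : 𝒳 → ℝ} {W : 𝒳 → 𝒴 → ℝ} (hP : ∀ x, 0 < P x)
    (hW : ∀ x y, 0 ≤ W x y) {x : 𝒳} {y : 𝒴} (hxy : 0 < W x y) : 0 < outDist P W y :=
  (mul_pos (hP x) hxy).trans_le <| Finset.single_le_sum (f := fun x => P x * W x y)
    (fun x _ => mul_nonneg (hP x).le (hW x y)) (Finset.mem_univ x)

theorem sum_outDist {P : 𝒳 → ℝ} {W : 𝒳 → 𝒴 → ℝ} (hP : IsDist P)
    (hW : ∀ x, ∑ y, W x y = 1) : ∑ y, outDist P W y = 1 := by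
  simp only [outDist]
  rw [Finset.sum_comm]
  simp only [← Finset.mul_sum, hW, mul_one, hP.2]

omit [Fintype 𝒳] [Fintype 𝒴] in
theorem codeLaw_nonneg {W1 W2 : 𝒳 → 𝒴 → ℝ} (hW1 : ∀ x y, 0 ≤ W1 x y)
    (hW2 : ∀ x y, 0 ≤ W2 x y) (n M : ℕ) (f : Fin M → (Fin n → 𝒴) → (Fin n → 𝒴) → Fin n → 𝒳)
    (j : Fin M) (y1 y2 : Fin n → 𝒴) : 0 ≤ codeLaw W1 W2 n M f j y1 y2 :=
  mul_nonneg (by positivity) (Finset.prod_nonneg fun _ _ => mul_nonneg (hW1 _ _) (hW2 _ _))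

omit [Fintype 𝒳] [Fintype 𝒴] in
theorem codeLaw_swap (W1 W2 : 𝒳 → 𝒴 → ℝ) (n M : ℕ)
    (f : Fin M → (Fin n → 𝒴) → (Fin n → 𝒴) → Fin n → 𝒳) (j : Fin M) (y1 y2 : Fin n → 𝒴) :
    codeLaw W2 W1 n M (fun j a b => f j b a) j y2 y1 = codeLaw W1 W2 n M f j y1 y2 := by
  simp only [codeLaw, mul_comm (W1 _ _)]

omit [Fintype 𝒳] in
theorem errProb1_swap (W1 W2 : 𝒳 → 𝒴 → ℝ) (n M : ℕ)
    (f : Fin M → (Fin n → 𝒴) → (Fin n → 𝒴) → Fin n → 𝒳) (g : (Fin n → 𝒴) → Fin M) :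
    errProb1 W2 W1 n M (fun j a b => f j b a) g = errProb2 W1 W2 n M f g := by
  simp only [errProb1, errProb2, codeLaw_swap]
  exact Finset.sum_congr rfl fun _ _ => Finset.sum_comm

omit [Fintype 𝒴] in
/-- Change of measure: a bound on the total information density bounds the product channel law
by the product output law. -/
theorem prod_le_of_sum_infoDens_le {P : 𝒳 → ℝ} {W : 𝒳 → 𝒴 → ℝ} (hP : ∀ x, 0 < P x)
    (hW : ∀ x y, 0 ≤ W x y) {ι : Type*} [Fintype ι] (x : ι → 𝒳) (y : ι → 𝒴) {c : ℝ}
    (h : ∑ i, infoDens P W (x i) (y i) ≤ c) :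
    ∏ i, W (x i) (y i) ≤ Real.exp c * ∏ i, outDist P W (y i) := by
  by_cases hpos : ∀ i, 0 < W (x i) (y i)
  · have hexp (i : ι) : W (x i) (y i)
        = Real.exp (infoDens P W (x i) (y i)) * outDist P W (y i) := by
      have hq := outDist_pos hP hW (hpos i)
      rw [infoDens, Real.exp_log (div_pos (hpos i) hq), div_mul_cancel₀ _ hq.ne']
    rw [Finset.prod_congr rfl fun i _ => hexp i, Finset.prod_mul_distrib, ← Real.exp_sum]
    exact mul_le_mul_of_nonneg_right (Real.exp_le_exp.mpr h)
      (Finset.prod_nonneg fun i _ => outDist_nonneg (fun x => (hP x).le) hW _)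
  · push Not at hpos
    obtain ⟨i, hi⟩ := hpos
    rw [Finset.prod_eq_zero (Finset.mem_univ i) (le_antisymm hi (hW _ _))]
    exact mul_nonneg (Real.exp_pos c).le
      (Finset.prod_nonneg fun i _ => outDist_nonneg (fun x => (hP x).le) hW _)

open scoped Classical in
/-- Verdú–Han type converse for a single decoder of a feedback code. -/
theorem sum_codeLaw_infoDens_le
    {W1 W2 : 𝒳 → 𝒴 → ℝ}
    (hW1 : ∀ x y, 0 ≤ W1 x y) (hW1sum : ∀ x, ∑ y, W1 x y = 1)
    (hW2 : ∀ x y, 0 ≤ W2 x y) (hW2sum : ∀ x, ∑ y, W2 x y = 1)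
    {P : 𝒳 → ℝ} (hP : IsDist P) (hPpos : ∀ x, 0 < P x)
    {n M : ℕ} (hM : 0 < M)
    {f : Fin M → (Fin n → 𝒴) → (Fin n → 𝒴) → Fin n → 𝒳} (hf : Causal n M f)
    (g : (Fin n → 𝒴) → Fin M) (lam : ℝ) :
    (∑ j, ∑ y1 : Fin n → 𝒴, ∑ y2 : Fin n → 𝒴,
        if ∑ i, infoDens P W1 (f j y1 y2 i) (y1 i) ≤ Real.log M - lam
        then codeLaw W1 W2 n M f j y1 y2 else 0)
      ≤ errProb1 W1 W2 n M f g + Real.exp (-lam) := by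
  have hMpos : (0 : ℝ) < M := Nat.cast_pos.mpr hM
  have : Nonempty 𝒴 := by
    by_contra hemp
    rw [not_nonempty_iff] at hemp
    have hX : IsEmpty 𝒳 := ⟨fun x => by simpa using hW1sum x⟩
    simpa using hP.2
  have hq (y1 : Fin n → 𝒴) : 0 ≤ ∏ i, outDist P W1 (y1 i) :=
    Finset.prod_nonneg fun i _ => outDist_nonneg (fun x => (hPpos x).le) hW1 _
  have hw (j : Fin M) (y1 y2 : Fin n → 𝒴) : 0 ≤ ∏ i, W2 (f j y1 y2 i) (y2 i) :=
    Finset.prod_nonneg fun i _ => hW2 _ _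
  have htotal : (∑ j, ∑ y1 : Fin n → 𝒴, ∑ y2 : Fin n → 𝒴,
      if g y1 = j then Real.exp (-lam) * (∏ i, outDist P W1 (y1 i))
        * ∏ i, W2 (f j y1 y2 i) (y2 i) else 0) = Real.exp (-lam) := by
    have hinner (j : Fin M) (y1 : Fin n → 𝒴) : (∑ y2 : Fin n → 𝒴,
        if g y1 = j then Real.exp (-lam) * (∏ i, outDist P W1 (y1 i))
          * ∏ i, W2 (f j y1 y2 i) (y2 i) else 0)
        = if g y1 = j then Real.exp (-lam) * ∏ i, outDist P W1 (y1 i) else 0 := by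
      split_ifs
      · rw [← Finset.mul_sum, sum_prod_causal W2 hW2sum n (f j y1)
          fun y y' i h => hf j y1 y1 y y' i (fun _ _ => rfl) h, mul_one]
      · simp
    simp only [hinner]
    rw [Finset.sum_comm]
    simp only [Finset.sum_ite_eq, Finset.mem_univ, if_true]
    rw [← Finset.mul_sum, ← Fintype.sum_pow (outDist P W1) n, sum_outDist hP hW1sum, one_pow,
      mul_one]
  calc _ ≤ ∑ j, ∑ y1 : Fin n → 𝒴, ∑ y2 : Fin n → 𝒴,
        ((if g y1 = j then 0 else codeLaw W1 W2 n M f j y1 y2)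
          + if g y1 = j then Real.exp (-lam) * (∏ i, outDist P W1 (y1 i))
            * ∏ i, W2 (f j y1 y2 i) (y2 i) else 0) := by
        refine Finset.sum_le_sum fun j _ => Finset.sum_le_sum fun y1 _ =>
          Finset.sum_le_sum fun y2 _ => ?_
        by_cases hg : g y1 = j
        · rw [if_pos hg, if_pos hg, zero_add]
          split_ifs with hi
          · have hle := prod_le_of_sum_infoDens_le hPpos hW1 (f j y1 y2) y1 hi
            rw [sub_eq_add_neg, Real.exp_add, Real.exp_log hMpos] at hle
            rw [codeLaw, Finset.prod_mul_distrib, ← mul_assoc]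
            refine mul_le_mul_of_nonneg_right ?_ (hw j y1 y2)
            rw [one_div, inv_mul_le_iff₀ hMpos, ← mul_assoc]
            exact hle
          · exact mul_nonneg (mul_nonneg (Real.exp_pos _).le (hq y1)) (hw j y1 y2)
        · rw [if_neg hg, if_neg hg, add_zero]
          split_ifs
          · exact le_rfl
          · exact codeLaw_nonneg hW1 hW2 n M f j y1 y2
    _ = errProb1 W1 W2 n M f g + Real.exp (-lam) := by
        simp only [Finset.sum_add_distrib, htotal, errProb1]

open scoped Classical in
/-- **Theorem 1** (nonasymptotic converse for fixed-length feedback codes):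
every `(n, M, ε)`-FLF code satisfies, for every `λ > 0`,
`ε ≥ ½ ℙ[η Σᵢ i₁ + (1-η) Σᵢ i₂ ≤ log M − λ] − e^{−λ}`. -/
theorem flf_nonasymptotic_converse
    (W1 W2 : 𝒳 → 𝒴 → ℝ)
    (hW1 : ∀ x y, 0 ≤ W1 x y) (hW1sum : ∀ x, ∑ y, W1 x y = 1)
    (hW2 : ∀ x y, 0 ≤ W2 x y) (hW2sum : ∀ x, ∑ y, W2 x y = 1)
    (Pstar : 𝒳 → ℝ) (C C1 C2 : ℝ)
    (hPstar : IsDist Pstar) (hPpos : ∀ x, 0 < Pstar x)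
    (hCach : min (mutInfo Pstar W1) (mutInfo Pstar W2) = C)
    (hCmax : ∀ P, IsDist P → min (mutInfo P W1) (mutInfo P W2) ≤ C)
    (hUniq : ∀ P, IsDist P → min (mutInfo P W1) (mutInfo P W2) = C → P = Pstar)
    (hC1 : IsLUB {r | ∃ P, IsDist P ∧ r = mutInfo P W1} C1)
    (hC2 : IsLUB {r | ∃ P, IsDist P ∧ r = mutInfo P W2} C2)
    (hC1gt : C < C1) (hC2gt : C < C2)
    (η : ℝ) (hη : η ∈ Set.Ioo (0 : ℝ) 1)
    (hηeq : ∀ v : 𝒳 → ℝ, ∑ x, v x = 0 →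
      η * gradI Pstar W1 v + (1 - η) * gradI Pstar W2 v = 0)
    (n M : ℕ) (hM : 0 < M) (ε : ℝ)
    (f : Fin M → (Fin n → 𝒴) → (Fin n → 𝒴) → Fin n → 𝒳)
    (hf : Causal n M f)
    (g1 g2 : (Fin n → 𝒴) → Fin M)
    (herr1 : errProb1 W1 W2 n M f g1 ≤ ε)
    (herr2 : errProb2 W1 W2 n M f g2 ≤ ε)
    (lam : ℝ) (hlam : 0 < lam) :
    ε ≥ (1 / 2) *
        (∑ j, ∑ y1 : Fin n → 𝒴, ∑ y2 : Fin n → 𝒴,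
          if η * (∑ i, infoDens Pstar W1 (f j y1 y2 i) (y1 i))
              + (1 - η) * (∑ i, infoDens Pstar W2 (f j y1 y2 i) (y2 i))
              ≤ Real.log M - lam
          then codeLaw W1 W2 n M f j y1 y2 else 0)
      - Real.exp (-lam) := by
  have h1 := sum_codeLaw_infoDens_le hW1 hW1sum hW2 hW2sum hPstar hPpos hM hf g1 lam
  have h2 := sum_codeLaw_infoDens_le hW2 hW2sum hW1 hW1sum hPstar hPpos hM
    (f := fun j a b => f j b a) (fun j a a' b b' i ha hb => hf j b b' a a' i hb ha) g2 lam
  rw [errProb1_swap] at h2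
  simp only [codeLaw_swap] at h2
  rw [Finset.sum_congr rfl fun j _ => Finset.sum_comm] at h2
  have hunion : (∑ j, ∑ y1 : Fin n → 𝒴, ∑ y2 : Fin n → 𝒴,
          if η * (∑ i, infoDens Pstar W1 (f j y1 y2 i) (y1 i))
              + (1 - η) * (∑ i, infoDens Pstar W2 (f j y1 y2 i) (y2 i))
              ≤ Real.log M - lam
          then codeLaw W1 W2 n M f j y1 y2 else 0)
      ≤ ∑ j, ∑ y1 : Fin n → 𝒴, ∑ y2 : Fin n → 𝒴,
        ((if ∑ i, infoDens Pstar W1 (f j y1 y2 i) (y1 i) ≤ Real.log M - lam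
          then codeLaw W1 W2 n M f j y1 y2 else 0)
        + if ∑ i, infoDens Pstar W2 (f j y1 y2 i) (y2 i) ≤ Real.log M - lam
          then codeLaw W1 W2 n M f j y1 y2 else 0) := by
    refine Finset.sum_le_sum fun j _ => Finset.sum_le_sum fun y1 _ =>
      Finset.sum_le_sum fun y2 _ => ?_
    have hnn := codeLaw_nonneg hW1 hW2 n M f j y1 y2
    split_ifs with h ha hb hb
    any_goals linarith
    nlinarith [mul_pos hη.1 (sub_pos.mpr (not_le.mp ha)),
      mul_pos (sub_pos.mpr hη.2) (sub_pos.mpr (not_le.mp hb))]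
  simp only [Finset.sum_add_distrib] at hunion
  linarith
end
end
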